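/- A general cubic fourfold apolar to a Veronese surface is apolar to only finitely many Veronese surfaces. Precisely: there exists a nonzero polynomial function P on the 28-dimensional space of sextic forms in 3 variables such that for every sextic g with P(g) ≠ 0, the collection of cones {A·ν(ℂ³) : A ∈ GL₆(ℂ)} (viewed as a set of subsets of ℂ⁶) on which every vanishing cubic k satisfies ⟨s(g),k⟩ = 0, is a finite set. (Proposition \ref{lefiniteveronese}(ii) of the paper.) -/

import Mathlib

open MvPolynomial

/-- The constant-coefficient differential operator associated with the monomial
exponent `d`: the composition over `i` of `(∂/∂xᵢ)^(d i)`. -/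
noncomputable def monOp {n : ℕ} (d : Fin n →₀ ℕ) :
    Module.End ℂ (MvPolynomial (Fin n) ℂ) :=
  (List.ofFn fun i : Fin n =>
    ((pderiv (R := ℂ) i).toLinearMap : Module.End ℂ (MvPolynomial (Fin n) ℂ)) ^ (d i)).prod

/-- The apolarity action `g ∘ f` : apply `g`, viewed as a constant-coefficient
differential operator, to `f`. -/
noncomputable def apolar {n : ℕ} (g f : MvPolynomial (Fin n) ℂ) :
    MvPolynomial (Fin n) ℂ :=
  ∑ d ∈ g.support, coeff d g • monOp d f

/-- The apolarity pairing `⟨f, k⟩ := k ∘ f` (its constant term). -/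
noncomputable def pairing {n : ℕ} (f k : MvPolynomial (Fin n) ℂ) : ℂ :=
  eval (fun _ => (0 : ℂ)) (apolar k f)

/-- The linear form `Σ vᵢ xᵢ` associated with a vector `v`. -/
noncomputable def linForm {n : ℕ} (v : Fin n → ℂ) : MvPolynomial (Fin n) ℂ :=
  ∑ i, MvPolynomial.C (v i) * X i

/-- The directional partial derivative `∂_v f = Σ vᵢ ∂f/∂xᵢ`. -/
noncomputable def pdir {n : ℕ} (v : Fin n → ℂ) (f : MvPolynomial (Fin n) ℂ) :
    MvPolynomial (Fin n) ℂ :=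
  ∑ i, MvPolynomial.C (v i) * pderiv i f

/-- The Veronese map `ν : ℂ³ → ℂ⁶`. -/
noncomputable def nu (w : Fin 3 → ℂ) : Fin 6 → ℂ :=
  ![w 0 ^ 2, 2 * w 0 * w 1, 2 * w 0 * w 2, w 1 ^ 2, 2 * w 1 * w 2, w 2 ^ 2]

/-- The components of the Veronese map as quadratic forms in `y₀, y₁, y₂`. -/
noncomputable def nuPoly : Fin 6 → MvPolynomial (Fin 3) ℂ :=
  ![X 0 ^ 2, 2 * X 0 * X 1, 2 * X 0 * X 2, X 1 ^ 2, 2 * X 1 * X 2, X 2 ^ 2]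

/-- A quadratic form `q` in 6 variables has rank `≤ r`: there is a symmetric matrix
`M` of rank `≤ r` with `q(x) = xᵀ M x`. -/
def QuadRankLe (q : MvPolynomial (Fin 6) ℂ) (r : ℕ) : Prop :=
  ∃ M : Matrix (Fin 6) (Fin 6) ℂ, M.IsSymm ∧ M.rank ≤ r ∧
    ∀ x : Fin 6 → ℂ, eval x q = ∑ i, ∑ j, M i j * x i * x j

/-- `s` is the linear map carrying a ternary sextic `g` to the cubic `s(g)` in six
variables, characterized by `⟨s(g), k⟩ = ⟨g, m(k)⟩` for all cubic forms `k`, where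
`m(k) = k ∘ ν`. -/
def IsSMap (s : MvPolynomial (Fin 3) ℂ →ₗ[ℂ] MvPolynomial (Fin 6) ℂ) : Prop :=
  (∀ g : MvPolynomial (Fin 3) ℂ, g.IsHomogeneous 6 → (s g).IsHomogeneous 3) ∧
  ∀ g : MvPolynomial (Fin 3) ℂ, ∀ k : MvPolynomial (Fin 6) ℂ,
    g.IsHomogeneous 6 → k.IsHomogeneous 3 →
      pairing (s g) k = pairing g (aeval nuPoly k)

/-- Evaluation of a polynomial function `P` in the coefficients at a polynomial `g`. -/
noncomputable def evalCoeff {σ : Type} (g : MvPolynomial σ ℂ) (P : MvPolynomial (σ →₀ ℕ) ℂ) : ℂ :=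
  eval (fun d => coeff d g) P

/-- The vanishing ideal of a subset of `ℂ⁵⁶`. -/
noncomputable def vanishingIdealOf (S : Set (Fin 56 → ℂ)) : Ideal (MvPolynomial (Fin 56) ℂ) :=
  ⨅ x ∈ S, RingHom.ker (eval x)

/-- An ideal is a prime ideal of height one: it is prime, admits a prime strictly
below it, and admits no chain of two primes strictly below it. -/
def IsHeightOnePrime {R : Type*} [CommRing R] (I : Ideal R) : Prop :=
  I.IsPrime ∧ (∃ p : Ideal R, p.IsPrime ∧ p < I) ∧
    ∀ p q : Ideal R, p.IsPrime → q.IsPrime → p < q → ¬ q < I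

/-- The space `Q_{f,U}` of quadratic forms vanishing on `U` and apolar to `f`. -/
def QfU (f : MvPolynomial (Fin 6) ℂ) (U : Submodule ℂ (Fin 6 → ℂ)) :
    Set (MvPolynomial (Fin 6) ℂ) :=
  {q | q.IsHomogeneous 2 ∧ (∀ u ∈ U, eval u q = 0) ∧ apolar q f = 0}

/-- The Zariski closure of a subset of `ℂ⁵⁶`. -/
def zcl (S : Set (Fin 56 → ℂ)) : Set (Fin 56 → ℂ) :=
  {x | ∀ P : MvPolynomial (Fin 56) ℂ, (∀ y ∈ S, eval y P = 0) → eval x P = 0}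

/-- The projection of a polynomial onto its squarefree monomials. -/
noncomputable def sqfreeProj (f : MvPolynomial (Fin 6) ℂ) : MvPolynomial (Fin 6) ℂ :=
  ∑ d ∈ f.support.filter (fun d => ∀ i, d i ≤ 1), monomial d (coeff d f)


open scoped TensorProduct

/-- In characteristic zero, a derivation can be prescribed on algebraically independent elements. -/
theorem exists_derivation_of_algebraicIndependent {k L κ : Type*} [Field k] [CharZero k]
    [Field L] [Algebra k L] {x : κ → L} (hx : AlgebraicIndependent k x) (v : κ → L) :
    ∃ D : Derivation k L L, ∀ d, D (x d) = v d := by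
  let S := MvPolynomial κ k
  let : Algebra S L := (aeval x).toAlgebra
  have : IsScalarTower k S L := IsScalarTower.of_algebraMap_eq fun c =>
    ((aeval x).commutes c).symm
  have hinj : Function.Injective (algebraMap S L) := hx
  have : FaithfulSMul S L := (faithfulSMul_iff_algebraMap_injective S L).2 hinj
  have : CharZero L := charZero_of_injective_algebraMap (algebraMap k L).injective
  let K := FractionRing S
  let : Algebra K L := FractionRing.liftAlgebra S L
  have : IsScalarTower S K L := FractionRing.isScalarTower_liftAlgebra S L
  have : CharZero K := charZero_of_injective_algebraMap (algebraMap k K).injective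
  have : Algebra.FormallySmooth S K := .of_isLocalization (nonZeroDivisors S)
  have : Algebra.FormallySmooth K L := by
    obtain ⟨s, hs⟩ := exists_isTranscendenceBasis K L
    have := hs.isAlgebraic_field
    exact .of_algebraicIndependent_of_isSeparable hs.1
  have : Algebra.FormallySmooth S L := .comp S K L
  have hmap : Function.Injective (KaehlerDifferential.mapBaseChange k S L) := by
    rw [injective_iff_map_eq_zero]
    intro a ha
    obtain ⟨b, rfl⟩ := (Algebra.H1Cotangent.exact_δ_mapBaseChange k S L a).1 ha
    rw [Subsingleton.elim b 0, map_zero]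
  obtain ⟨r, hr⟩ := LinearMap.exists_leftInverse_of_injective _ (LinearMap.ker_eq_bot.2 hmap)
  let D₀ : Derivation k S L := mkDerivation k v
  let φ : L ⊗[S] Ω[S⁄k] →ₗ[L] L := LinearMap.liftBaseChange L D₀.liftKaehlerDifferential
  refine ⟨(φ ∘ₗ r).compDer (KaehlerDifferential.D k L), fun d => ?_⟩
  have h1 : KaehlerDifferential.D k L (x d) =
      KaehlerDifferential.mapBaseChange k S L (1 ⊗ₜ KaehlerDifferential.D k S (X d)) := by
    have : algebraMap S L (X d) = x d := aeval_X x d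
    simp [this]
  have h2 := LinearMap.congr_fun hr (1 ⊗ₜ KaehlerDifferential.D k S (X d))
  change φ (r (KaehlerDifferential.D k L (x d))) = v d
  rw [h1]
  erw [h2]
  simp [φ, D₀]
  exact mkDerivation_X ..

/-- If `c` vanishes at every solution of a polynomial system over an extension field at which
arbitrary derivatives of the parameters indexed by `κ` can be prescribed, then `c` vanishes at all
complex solutions with generic parameters. -/
theorem exists_generic_of_derivations {ι κ : Type} (I : Set (MvPolynomial (ι ⊕ κ) ℂ))
    (c : MvPolynomial (ι ⊕ κ) ℂ)
    (h : ∀ (L : Type) [Field L] [Algebra ℂ L] (x : ι ⊕ κ → L), (∀ p ∈ I, aeval x p = 0) →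
      (∀ v : κ → L, ∃ D : Derivation ℂ L L, ∀ d, D (x (Sum.inr d)) = v d) → aeval x c = 0) :
    ∃ Q : MvPolynomial κ ℂ, Q ≠ 0 ∧ ∀ x : ι ⊕ κ → ℂ, (∀ p ∈ I, eval x p = 0) →
      eval (x ∘ Sum.inr) Q ≠ 0 → eval x c = 0 := by
  let J := Ideal.span I
  let M : Submonoid (MvPolynomial (ι ⊕ κ) ℂ) :=
    (nonZeroDivisors (MvPolynomial κ ℂ)).map (rename (Sum.inr : κ → ι ⊕ κ)) ⊔ Submonoid.powers c
  by_cases hd : Disjoint (J : Set (MvPolynomial (ι ⊕ κ) ℂ)) M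
  · exfalso
    obtain ⟨p, hp, hJp, hpM⟩ := Ideal.exists_le_prime_disjoint J M hd
    let L := FractionRing (MvPolynomial (ι ⊕ κ) ℂ ⧸ p)
    let x : ι ⊕ κ → L := fun i => algebraMap _ L (Ideal.Quotient.mk p (X i))
    have hx : ∀ q, aeval x q = algebraMap _ L (Ideal.Quotient.mk p q) := by
      intro q
      have : aeval x = (IsScalarTower.toAlgHom ℂ (MvPolynomial (ι ⊕ κ) ℂ ⧸ p) L).comp
          (Ideal.Quotient.mkₐ ℂ p) := by
        ext i; simp [x]
      rw [this]; rfl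
    have hx0 : ∀ q, aeval x q = 0 ↔ q ∈ p := by
      intro q
      rw [hx, FaithfulSMul.algebraMap_eq_zero_iff, Ideal.Quotient.eq_zero_iff_mem]
    have hnot : ∀ q ∈ M, q ∉ p := fun q hq hqp => Set.disjoint_left.1 hpM hqp hq
    refine hnot c (Submonoid.mem_sup_right (Submonoid.mem_powers c)) ((hx0 c).1 (h L x
      (fun q hq => (hx0 q).2 (hJp (Ideal.subset_span hq)))
      (exists_derivation_of_algebraicIndependent ?_)))
    rw [algebraicIndependent_iff]
    intro q hq
    by_contra hne
    refine hnot _ (Submonoid.mem_sup_left ⟨q, mem_nonZeroDivisors_of_ne_zero hne, rfl⟩)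
      ((hx0 _).1 ?_)
    exact (aeval_rename ..).trans hq
  · obtain ⟨q, hqJ, hqM⟩ := Set.not_disjoint_iff.1 hd
    obtain ⟨_, ⟨Q, hQ, rfl⟩, _, ⟨n, rfl⟩, rfl⟩ := Submonoid.mem_sup.1 hqM
    refine ⟨Q, nonZeroDivisors.ne_zero hQ, fun x hx hQx => ?_⟩
    have hJ : J ≤ RingHom.ker (eval x) := Ideal.span_le.2 hx
    have := hJ hqJ
    rw [RingHom.mem_ker, map_mul] at this
    have h' := (mul_eq_zero.1 this).resolve_left (by simpa [eval_rename] using hQx)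
    simpa using eq_zero_of_pow_eq_zero (by simpa using h')

/-- Let `H d` be symmetric trilinear forms. For generic `g`, every singular point of the cubic form
`∑ d, g d * H d b b b` is a common zero of all the cubic forms `H d b b b`. -/
theorem exists_generic_cubic {P κ : Type} [Fintype P] [Fintype κ] (H : κ → P → P → P → ℂ)
    (h₁ : ∀ d p q r, H d p q r = H d q p r) (h₂ : ∀ d p q r, H d p q r = H d p r q) :
    ∃ Q : MvPolynomial κ ℂ, Q ≠ 0 ∧ ∀ (b : P → ℂ) (g : κ → ℂ), eval g Q ≠ 0 →
      (∀ p, ∑ q, ∑ r, ∑ d, H d p q r * (b q * b r * g d) = 0) →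
      ∀ d, ∑ p, ∑ q, ∑ r, H d p q r * (b p * b q * b r) = 0 := by
  let E : P → MvPolynomial (P ⊕ κ) ℂ := fun p =>
    ∑ q, ∑ r, ∑ d, C (H d p q r) * (X (Sum.inl q) * X (Sum.inl r) * X (Sum.inr d))
  let F : κ → MvPolynomial (P ⊕ κ) ℂ := fun d =>
    ∑ p, ∑ q, ∑ r, C (H d p q r) * (X (Sum.inl p) * X (Sum.inl q) * X (Sum.inl r))
  have key : ∀ e, ∃ Q : MvPolynomial κ ℂ, Q ≠ 0 ∧ ∀ x : P ⊕ κ → ℂ,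
      (∀ p ∈ Set.range E, eval x p = 0) → eval (x ∘ Sum.inr) Q ≠ 0 → eval x (F e) = 0 := by
    classical
    intro e
    refine exists_generic_of_derivations _ _ fun L _ _ x hx hD => ?_
    obtain ⟨D, hD⟩ := hD (Pi.single e 1)
    have hE : ∀ p, ∑ q, ∑ r, ∑ d,
        H d p q r • (x (Sum.inl q) * x (Sum.inl r) * x (Sum.inr d)) = 0 := by
      intro p
      simpa [E, Algebra.smul_def] using hx (E p) ⟨p, rfl⟩
    have hDE : ∀ p, ∑ q, ∑ r, ∑ d, (
        H d p q r • (D (x (Sum.inl q)) * x (Sum.inl r) * x (Sum.inr d)) +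
        H d p q r • (x (Sum.inl q) * D (x (Sum.inl r)) * x (Sum.inr d)) +
        H d p q r • (x (Sum.inl q) * x (Sum.inl r) * D (x (Sum.inr d)))) = 0 := by
      intro p
      rw [← map_zero D, ← hE p]
      simp only [map_sum, Derivation.map_smul, Derivation.leibniz, ← smul_add, smul_eq_mul]
      refine Finset.sum_congr rfl fun q _ => Finset.sum_congr rfl fun r _ =>
        Finset.sum_congr rfl fun d _ => ?_
      congr 1
      ring
    have hsum : ∑ p, x (Sum.inl p) * ∑ q, ∑ r, ∑ d, (
        H d p q r • (D (x (Sum.inl q)) * x (Sum.inl r) * x (Sum.inr d)) +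
        H d p q r • (x (Sum.inl q) * D (x (Sum.inl r)) * x (Sum.inr d)) +
        H d p q r • (x (Sum.inl q) * x (Sum.inl r) * D (x (Sum.inr d)))) = 0 := by
      simp [hDE]
    have hfirst : ∑ p, ∑ q, ∑ r, ∑ d, H d p q r •
        (x (Sum.inl p) * (D (x (Sum.inl q)) * x (Sum.inl r) * x (Sum.inr d))) = 0 := by
      rw [Finset.sum_comm]
      refine Finset.sum_eq_zero fun q _ => ?_
      rw [← mul_zero (D (x (Sum.inl q))), ← hE q]
      simp only [Finset.mul_sum, mul_smul_comm]
      refine Finset.sum_congr rfl fun p _ => Finset.sum_congr rfl fun r _ =>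
        Finset.sum_congr rfl fun d _ => ?_
      rw [h₁]
      congr 1
      ring
    have hsecond : ∑ p, ∑ q, ∑ r, ∑ d, H d p q r •
        (x (Sum.inl p) * (x (Sum.inl q) * D (x (Sum.inl r)) * x (Sum.inr d))) = 0 := by
      rw [← hfirst]
      refine Finset.sum_congr rfl fun p _ => ?_
      rw [Finset.sum_comm]
      refine Finset.sum_congr rfl fun q _ => Finset.sum_congr rfl fun r _ =>
        Finset.sum_congr rfl fun d _ => ?_
      rw [h₂]
      congr 1
      ring
    simp only [Finset.mul_sum, mul_add, mul_smul_comm, Finset.sum_add_distrib] at hsum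
    rw [hfirst, hsecond, zero_add, zero_add] at hsum
    simp only [hD, Pi.single_apply, mul_ite, mul_one, mul_zero, smul_ite, smul_zero,
      Finset.sum_ite_eq', Finset.mem_univ, if_true] at hsum
    simpa [F, Algebra.smul_def, mul_assoc] using hsum
  choose Q hQ hQF using key
  refine ⟨∏ d, Q d, Finset.prod_ne_zero_iff.2 fun d _ => hQ d, fun b g hg hE d => ?_⟩
  have hd : eval g (Q d) ≠ 0 := by
    rw [map_prod] at hg
    exact Finset.prod_ne_zero_iff.1 hg d (Finset.mem_univ d)
  have := hQF d (Sum.elim b g) (by rintro _ ⟨p, rfl⟩; simpa [E] using hE p) (by simpa using hd)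
  simpa [F] using this

/-- A linear pencil which is injective for some parameter is injective for a generic parameter. -/
theorem exists_generic_injective {V W κ : Type*} [AddCommGroup V] [Module ℂ V]
    [FiniteDimensional ℂ V] [AddCommGroup W] [Module ℂ W] [Fintype κ]
    (M₀ : V →ₗ[ℂ] W) (M₁ : κ → V →ₗ[ℂ] W) (g₁ : κ → ℂ)
    (h : LinearMap.ker (M₀ + ∑ d, g₁ d • M₁ d) = ⊥) :
    ∃ Q : MvPolynomial κ ℂ, Q ≠ 0 ∧ ∀ g : κ → ℂ, eval g Q ≠ 0 →
      ∀ v, (M₀ + ∑ d, g d • M₁ d) v = 0 → v = 0 := by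
  classical
  obtain ⟨N, hN⟩ := LinearMap.exists_leftInverse_of_injective _ h
  let b := Module.finBasis ℂ V
  let m : (V →ₗ[ℂ] W) →ₗ[ℂ] Matrix _ _ ℂ :=
    (LinearMap.toMatrix b b).toLinearMap ∘ₗ LinearMap.llcomp ℂ V W V N
  let R : Matrix _ _ (MvPolynomial κ ℂ) :=
    (m M₀).map C + ∑ d, (X d : MvPolynomial κ ℂ) • (m (M₁ d)).map C
  have hR : ∀ g : κ → ℂ, eval g R.det =
      LinearMap.det (N ∘ₗ (M₀ + ∑ d, g d • M₁ d)) := by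
    intro g
    rw [← LinearMap.det_toMatrix b, RingHom.map_det]
    congr 1
    have : LinearMap.toMatrix b b (N ∘ₗ (M₀ + ∑ d, g d • M₁ d)) =
        m (M₀ + ∑ d, g d • M₁ d) := rfl
    rw [this, map_add, map_sum]
    ext i j
    simp [Matrix.sum_apply]
  refine ⟨R.det, fun h0 => ?_, fun g hg v hv => ?_⟩
  · have := hR g₁
    rw [hN, h0] at this
    simp at this
  · rw [hR] at hg
    have hinj := (LinearMap.equivOfDetNeZero _ hg).injective
    refine hinj ?_
    simp [hv]

/-- The third partial derivatives of the cubic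
`4 x₀ x₃ x₅ + x₁ x₂ x₄ - x₀ x₄² - x₃ x₂² - x₅ x₁²`, four times the determinant of the symmetric
matrix with diagonal `x₀, x₃, x₅` and off-diagonal entries `x₁ / 2, x₂ / 2, x₄ / 2`. -/
def detTensor : Fin 6 → Fin 6 → Fin 6 → ℤ :=
  ![![![0, 0, 0, 0, 0, 0], ![0, 0, 0, 0, 0, 0], ![0, 0, 0, 0, 0, 0],
      ![0, 0, 0, 0, 0, 4], ![0, 0, 0, 0, -2, 0], ![0, 0, 0, 4, 0, 0]],
    ![![0, 0, 0, 0, 0, 0], ![0, 0, 0, 0, 0, -2], ![0, 0, 0, 0, 1, 0],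
      ![0, 0, 0, 0, 0, 0], ![0, 0, 1, 0, 0, 0], ![0, -2, 0, 0, 0, 0]],
    ![![0, 0, 0, 0, 0, 0], ![0, 0, 0, 0, 1, 0], ![0, 0, 0, -2, 0, 0],
      ![0, 0, -2, 0, 0, 0], ![0, 1, 0, 0, 0, 0], ![0, 0, 0, 0, 0, 0]],
    ![![0, 0, 0, 0, 0, 4], ![0, 0, 0, 0, 0, 0], ![0, 0, -2, 0, 0, 0],
      ![0, 0, 0, 0, 0, 0], ![0, 0, 0, 0, 0, 0], ![4, 0, 0, 0, 0, 0]],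
    ![![0, 0, 0, 0, -2, 0], ![0, 0, 1, 0, 0, 0], ![0, 1, 0, 0, 0, 0],
      ![0, 0, 0, 0, 0, 0], ![-2, 0, 0, 0, 0, 0], ![0, 0, 0, 0, 0, 0]],
    ![![0, 0, 0, 4, 0, 0], ![0, -2, 0, 0, 0, 0], ![0, 0, 0, 0, 0, 0],
      ![4, 0, 0, 0, 0, 0], ![0, 0, 0, 0, 0, 0], ![0, 0, 0, 0, 0, 0]]]

theorem detTensor_swap_left (i j k : Fin 6) : detTensor i j k = detTensor j i k := by
  revert i j k; decide

theorem detTensor_swap_right (i j k : Fin 6) : detTensor i j k = detTensor i k j := by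
  revert i j k; decide

/-- The gradient of the cubic with third derivatives `detTensor`, in coordinates. -/
theorem sum_detTensor_mul {R : Type*} [CommRing R] (x : Fin 6 → R) (i : Fin 6) :
    ∑ j, ∑ k, (detTensor i j k : R) * (x j * x k) =
      2 * ![4 * x 3 * x 5 - x 4 ^ 2, x 2 * x 4 - 2 * x 1 * x 5, x 1 * x 4 - 2 * x 2 * x 3,
        4 * x 0 * x 5 - x 2 ^ 2, x 1 * x 2 - 2 * x 0 * x 4, 4 * x 0 * x 3 - x 1 ^ 2] i := by
  fin_cases i <;> simp [Fin.sum_univ_six, detTensor] <;> ring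

theorem sum_detTensor_mul_nu (w : Fin 3 → ℂ) (i : Fin 6) :
    ∑ j, ∑ k, (detTensor i j k : ℂ) * (nu w j * nu w k) = 0 := by
  rw [sum_detTensor_mul]
  fin_cases i <;> simp [nu] <;> ring

theorem sum_detTensor_mul_nuPoly (i : Fin 6) :
    ∑ j, ∑ k, (detTensor i j k : MvPolynomial (Fin 3) ℂ) * (nuPoly j * nuPoly k) = 0 := by
  rw [sum_detTensor_mul]
  fin_cases i <;> simp [nuPoly] <;> ring

theorem mem_range_nu_iff (x : Fin 6 → ℂ) :
    x ∈ Set.range nu ↔ ∀ i, ∑ j, ∑ k, (detTensor i j k : ℂ) * (x j * x k) = 0 := by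
  constructor
  · rintro ⟨w, rfl⟩ i
    exact sum_detTensor_mul_nu w i
  intro h
  simp only [sum_detTensor_mul] at h
  have e0 : 4 * x 3 * x 5 - x 4 ^ 2 = 0 := by simpa using h 0
  have e1 : x 2 * x 4 - 2 * x 1 * x 5 = 0 := by simpa using h 1
  have e2 : x 1 * x 4 - 2 * x 2 * x 3 = 0 := by simpa using h 2
  have e3 : 4 * x 0 * x 5 - x 2 ^ 2 = 0 := by simpa using h 3
  have e4 : x 1 * x 2 - 2 * x 0 * x 4 = 0 := by simpa using h 4
  have e5 : 4 * x 0 * x 3 - x 1 ^ 2 = 0 := by simpa using h 5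
  have hne : ∀ {a z : ℂ}, a ^ 2 = z → z ≠ 0 → a ≠ 0 := by
    rintro a _ rfl hz rfl
    simp at hz
  by_cases h0 : x 0 = 0
  · have h1 : x 1 = 0 := by simpa [h0] using e5
    have h2 : x 2 = 0 := by simpa [h0] using e3
    by_cases h3 : x 3 = 0
    · have h4 : x 4 = 0 := by simpa [h3] using e0
      obtain ⟨c, hc⟩ := IsAlgClosed.exists_pow_nat_eq (x 5) two_pos
      refine ⟨![0, 0, c], ?_⟩
      ext i
      fin_cases i <;> simp [nu, h0, h1, h2, h3, h4, hc]
    · obtain ⟨b, hb⟩ := IsAlgClosed.exists_pow_nat_eq (x 3) two_pos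
      have hb0 := hne hb h3
      refine ⟨![0, b, x 4 / (2 * b)], ?_⟩
      ext i
      fin_cases i <;> simp [nu, h0, h1, h2, hb] <;> field_simp
      rw [hb]
      linear_combination -e0
  · obtain ⟨a, ha⟩ := IsAlgClosed.exists_pow_nat_eq (x 0) two_pos
    have ha0 := hne ha h0
    refine ⟨![a, x 1 / (2 * a), x 2 / (2 * a)], ?_⟩
    ext i
    fin_cases i <;> simp [nu, ha] <;> field_simp <;> rw [ha]
    · linear_combination -e5
    · linear_combination e4
    · linear_combination -e3

/-- The weights of the coordinates of `nuPoly`. -/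
def nuWeight : Fin 6 → Fin 3 → ℕ :=
  ![![2, 0, 0], ![1, 1, 0], ![1, 0, 1], ![0, 2, 0], ![0, 1, 1], ![0, 0, 2]]

/-- The coefficients of the coordinates of `nuPoly`. -/
def nuCoeff : Fin 6 → ℕ := ![1, 2, 2, 1, 2, 1]

theorem nuPoly_eq_monomial (a : Fin 6) :
    nuPoly a = monomial (Finsupp.equivFunOnFinite.symm (nuWeight a)) (nuCoeff a : ℂ) := by
  have hC : (C 2 : MvPolynomial (Fin 3) ℂ) = 2 := map_ofNat C 2
  rw [monomial_eq, Finsupp.prod_fintype _ _ (by simp), Fin.prod_univ_three]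
  fin_cases a <;> simp [nuPoly, nuWeight, nuCoeff, hC] <;> ring

theorem coeff_nuPoly_mul (d : Fin 3 → ℕ) (a b c : Fin 6) :
    coeff (Finsupp.equivFunOnFinite.symm d) (nuPoly a * nuPoly b * nuPoly c) =
      if nuWeight a + nuWeight b + nuWeight c = d then
        ((nuCoeff a * nuCoeff b * nuCoeff c : ℕ) : ℂ) else 0 := by
  have : Finsupp.equivFunOnFinite.symm (nuWeight a) + Finsupp.equivFunOnFinite.symm (nuWeight b) +
      Finsupp.equivFunOnFinite.symm (nuWeight c) =
      Finsupp.equivFunOnFinite.symm (nuWeight a + nuWeight b + nuWeight c) := by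
    ext i; simp
  simp only [nuPoly_eq_monomial, monomial_mul, coeff_monomial, this, Equiv.apply_eq_iff_eq]
  simp

theorem coeff_pderiv_pow {σ : Type*} (i : σ) (n : ℕ) (f : MvPolynomial σ ℂ) (m : σ →₀ ℕ) :
    coeff m ((((pderiv (R := ℂ) i).toLinearMap : Module.End ℂ (MvPolynomial σ ℂ)) ^ n) f) =
      coeff (m + Finsupp.single i n) f * ((m i + 1).ascFactorial n : ℂ) := by
  induction n generalizing m with
  | zero => simp
  | succ n ih =>
    rw [pow_succ', Module.End.mul_apply]
    change coeff m (pderiv i _) = _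
    rw [coeff_pderiv, ih]
    simp only [Finsupp.add_apply, Finsupp.single_eq_same, add_assoc, ← Finsupp.single_add,
      Nat.ascFactorial_succ]
    have h : ((m i + 1 : ℕ) : ℂ) * ((m i + 1 + 1).ascFactorial n : ℂ) =
        ((m i + 1 + n : ℕ) : ℂ) * ((m i + 1).ascFactorial n : ℂ) :=
      mod_cast Nat.succ_ascFactorial (m i + 1) n
    push_cast at h ⊢
    rw [add_comm 1 n]
    linear_combination (coeff (m + Finsupp.single i (n + 1)) f) * h

theorem eval_zero_monOp (d : Fin 3 →₀ ℕ) (f : MvPolynomial (Fin 3) ℂ) :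
    eval (fun _ => (0 : ℂ)) (monOp d f) = (∏ i, ((d i).factorial : ℂ)) * coeff d f := by
  have h0 : ∀ p : MvPolynomial (Fin 3) ℂ, eval (fun _ => (0 : ℂ)) p = coeff 0 p := by
    intro p
    rw [eval_zero', constantCoeff_eq]
  have hd : Finsupp.single 0 (d 0) + Finsupp.single 1 (d 1) + Finsupp.single 2 (d 2) = d := by
    ext i; fin_cases i <;> simp
  rw [h0, monOp]
  simp only [List.ofFn_succ, List.ofFn_zero, List.prod_cons, List.prod_nil, mul_one,
    Module.End.mul_apply, coeff_pderiv_pow]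
  simp [Fin.prod_univ_three, hd, Nat.one_ascFactorial]
  ring

/-- The exponents of the monomials of degree six in three variables. -/
abbrev SexticExponent : Type := Finset.finsuppAntidiag (Finset.univ : Finset (Fin 3)) 6

theorem mem_finsuppAntidiag_iff_degree (d : Fin 3 →₀ ℕ) :
    d ∈ Finset.finsuppAntidiag (Finset.univ : Finset (Fin 3)) 6 ↔ d.degree = 6 := by
  simp [Finset.mem_finsuppAntidiag, Finsupp.degree_eq_sum]

theorem pairing_eq_sum (f k : MvPolynomial (Fin 3) ℂ) (hk : k.IsHomogeneous 6) :
    pairing f k = ∑ d : SexticExponent,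
      (∏ i, ((d.1 i).factorial : ℂ)) * coeff d.1 k * coeff d.1 f := by
  have hsub : k.support ⊆ Finset.finsuppAntidiag Finset.univ 6 := by
    intro d hd
    rw [mem_finsuppAntidiag_iff_degree]
    by_contra hne
    exact mem_support_iff.1 hd (hk.coeff_eq_zero hne)
  rw [pairing, apolar, map_sum, Finset.sum_subset hsub, ← Finset.sum_coe_sort]
  · refine Finset.sum_congr rfl fun d _ => ?_
    rw [smul_eval, eval_zero_monOp]
    ring
  · intro d _ hd
    simp [notMem_support_iff.1 hd]

/-- The coefficients of the trilinear form `⟨g, νₐ ν_b ν_c⟩` as a linear form in the coefficients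
of `g`. -/
noncomputable def sexticTensor (d : SexticExponent) (a b c : Fin 6) : ℂ :=
  (∏ i, ((d.1 i).factorial : ℂ)) * coeff d.1 (nuPoly a * nuPoly b * nuPoly c)

theorem sexticTensor_swap_left (d : SexticExponent) (a b c : Fin 6) :
    sexticTensor d a b c = sexticTensor d b a c := by
  rw [sexticTensor, sexticTensor, mul_comm (nuPoly a)]

theorem sexticTensor_swap_right (d : SexticExponent) (a b c : Fin 6) :
    sexticTensor d a b c = sexticTensor d a c b := by
  rw [sexticTensor, sexticTensor, mul_right_comm]

theorem sum_detTensor_mul_sexticTensor (d : SexticExponent) (a s : Fin 6) :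
    ∑ b, ∑ c, (detTensor a b c : ℂ) * sexticTensor d s b c = 0 := by
  have h := congrArg (fun p => (∏ i, ((d.1 i).factorial : ℂ)) * coeff d.1 (nuPoly s * p))
    (sum_detTensor_mul_nuPoly a)
  simp only [mul_zero, coeff_zero, Finset.mul_sum, coeff_sum] at h
  rw [← h]
  refine Finset.sum_congr rfl fun b _ => Finset.sum_congr rfl fun c _ => ?_
  have hswap : nuPoly s * ((detTensor a b c : MvPolynomial (Fin 3) ℂ) * (nuPoly b * nuPoly c)) =
      C (detTensor a b c : ℂ) * (nuPoly s * nuPoly b * nuPoly c) := by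
    rw [map_intCast]
    ring
  rw [hswap, coeff_C_mul, sexticTensor]
  ring

/-- The exponent of degree six with given values. -/
noncomputable def sexticExponent (d : Fin 3 → ℕ) (hd : d 0 + d 1 + d 2 = 6) : SexticExponent :=
  ⟨Finsupp.equivFunOnFinite.symm d, by
    rw [mem_finsuppAntidiag_iff_degree, Finsupp.degree_eq_sum, Fin.sum_univ_three]
    simpa using hd⟩

theorem sexticTensor_sexticExponent (d : Fin 3 → ℕ) (hd : d 0 + d 1 + d 2 = 6) (a b c : Fin 6) :
    sexticTensor (sexticExponent d hd) a b c = (∏ i, ((d i).factorial : ℂ)) *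
      if nuWeight a + nuWeight b + nuWeight c = d then
        ((nuCoeff a * nuCoeff b * nuCoeff c : ℕ) : ℂ) else 0 := by
  rw [← coeff_nuPoly_mul]
  rfl

theorem sum_eq_zero_of_sexticTensor {K : Fin 6 → Fin 6 → Fin 6 → ℂ}
    (h : ∀ d, ∑ a, ∑ b, ∑ c, K a b c * sexticTensor d a b c = 0)
    (d : Fin 3 → ℕ) (hd : d 0 + d 1 + d 2 = 6) (s : Finset (Fin 6 × Fin 6 × Fin 6))
    (hs : Finset.univ.filter (fun p : Fin 6 × Fin 6 × Fin 6 =>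
      nuWeight p.1 + nuWeight p.2.1 + nuWeight p.2.2 = d) = s) :
    ∑ p ∈ s, K p.1 p.2.1 p.2.2 * (nuCoeff p.1 * nuCoeff p.2.1 * nuCoeff p.2.2) = 0 := by
  have h1 := h (sexticExponent d hd)
  have hne : ∏ i, ((d i).factorial : ℂ) ≠ 0 :=
    Finset.prod_ne_zero_iff.2 fun i _ => Nat.cast_ne_zero.2 (Nat.factorial_ne_zero _)
  rw [← hs, Finset.sum_filter]
  refine (mul_eq_zero.1 ?_).resolve_left hne
  refine Eq.trans ?_ h1
  rw [Finset.mul_sum, Fintype.sum_prod_type]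
  refine Finset.sum_congr rfl fun a _ => ?_
  rw [Fintype.sum_prod_type]
  refine Finset.sum_congr rfl fun b _ => Finset.sum_congr rfl fun c _ => ?_
  rw [sexticTensor_sexticExponent]
  split_ifs
  · push_cast
    ring
  · ring

set_option maxHeartbeats 2000000 in
/-- A symmetric tensor orthogonal to all sextics, whose contractions with `y₀² y₁² y₂²` vanish, is
determined by its entry at `(1, 2, 4)`. -/
theorem eq_zero_of_contractions {K : Fin 6 → Fin 6 → Fin 6 → ℂ}
    (h₁ : ∀ a b c, K a b c = K b a c) (h₂ : ∀ a b c, K a b c = K a c b)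
    (hA : ∀ d, ∑ a, ∑ b, ∑ c, K a b c * sexticTensor d a b c = 0)
    (hB : ∀ a s, ∑ b, ∑ c, K a b c * sexticTensor (sexticExponent ![2, 2, 2] (by decide)) s b c = 0)
    (h124 : K 1 2 4 = 0) : K = 0 := by
  have hB' : ∀ a s, ∑ b, ∑ c, K a b c * (if nuWeight s + nuWeight b + nuWeight c = ![2, 2, 2] then
      ((nuCoeff s * nuCoeff b * nuCoeff c : ℕ) : ℂ) else 0) = 0 := by
    intro a s
    have hne : ∏ i, ((![2, 2, 2] i).factorial : ℂ) ≠ 0 := by simp [Fin.prod_univ_three]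
    refine (mul_eq_zero.1 (Eq.trans ?_ (hB a s))).resolve_left hne
    simp only [Finset.mul_sum]
    refine Finset.sum_congr rfl fun b _ => Finset.sum_congr rfl fun c _ => ?_
    rw [sexticTensor_sexticExponent, mul_left_comm]
  have b0 : ∀ a, K a 3 5 = -2 * K a 4 4 := by
    intro a
    have h := hB' a 0
    simp [Fin.sum_univ_six, nuWeight, nuCoeff] at h
    linear_combination h / 2 + h₂ a 3 5 / 2
  have b1 : ∀ a, K a 1 5 = -2 * K a 2 4 := by
    intro a
    have h := hB' a 1
    simp [Fin.sum_univ_six, nuWeight, nuCoeff] at h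
    linear_combination h / 8 + h₂ a 1 5 / 2 + h₂ a 2 4
  have b2 : ∀ a, K a 2 3 = -2 * K a 1 4 := by
    intro a
    have h := hB' a 2
    simp [Fin.sum_univ_six, nuWeight, nuCoeff] at h
    linear_combination h / 8 + h₂ a 2 3 / 2 + h₂ a 1 4
  have b3 : ∀ a, K a 0 5 = -2 * K a 2 2 := by
    intro a
    have h := hB' a 3
    simp [Fin.sum_univ_six, nuWeight, nuCoeff] at h
    linear_combination h / 2 + h₂ a 0 5 / 2
  have b4 : ∀ a, K a 0 4 = -2 * K a 1 2 := by
    intro a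
    have h := hB' a 4
    simp [Fin.sum_univ_six, nuWeight, nuCoeff] at h
    linear_combination h / 8 + h₂ a 0 4 / 2 + h₂ a 1 2
  have b5 : ∀ a, K a 0 3 = -2 * K a 1 1 := by
    intro a
    have h := hB' a 5
    simp [Fin.sum_univ_six, nuWeight, nuCoeff] at h
    linear_combination h / 2 + h₂ a 0 3 / 2
  have cube : ∀ (a : Fin 6) (d : Fin 3 → ℕ) (hd : d 0 + d 1 + d 2 = 6), nuCoeff a ≠ 0 →
      Finset.univ.filter (fun p : Fin 6 × Fin 6 × Fin 6 =>
      nuWeight p.1 + nuWeight p.2.1 + nuWeight p.2.2 = d) = {(a, a, a)} → K a a a = 0 := by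
    intro a d hd ha hs
    simpa [ha] using sum_eq_zero_of_sexticTensor hA d hd _ hs
  have square : ∀ (a b : Fin 6) (d : Fin 3 → ℕ) (hd : d 0 + d 1 + d 2 = 6),
      (a ≠ b ∧ nuCoeff a ≠ 0 ∧ nuCoeff b ≠ 0) →
      Finset.univ.filter (fun p : Fin 6 × Fin 6 × Fin 6 =>
      nuWeight p.1 + nuWeight p.2.1 + nuWeight p.2.2 = d) = {(a, a, b), (a, b, a), (b, a, a)} →
      K a a b = 0 := by
    rintro a b d hd ⟨hab, ha, hb⟩ hs
    have h := sum_eq_zero_of_sexticTensor hA d hd _ hs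
    rw [Finset.sum_insert (by simp [hab]), Finset.sum_insert (by simp [hab.symm]),
      Finset.sum_singleton] at h
    have h' : K a a b * (nuCoeff a * nuCoeff a * nuCoeff b) = 0 := by
      simp only at h
      linear_combination h / 3 + (h₁ a b a - 2 * h₂ a b a) * (nuCoeff a * nuCoeff a * nuCoeff b) / 3
    simpa [ha, hb] using h'
  have square_mixed : ∀ (a b c : Fin 6) (d : Fin 3 → ℕ) (hd : d 0 + d 1 + d 2 = 6),
      (a ≠ b ∧ a ≠ c ∧ b ≠ c ∧ nuCoeff a = 1 ∧ nuCoeff b = 1 ∧ nuCoeff c = 2) →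
      Finset.univ.filter (fun p : Fin 6 × Fin 6 × Fin 6 =>
      nuWeight p.1 + nuWeight p.2.1 + nuWeight p.2.2 = d) =
        {(a, a, b), (a, b, a), (b, a, a), (a, c, c), (c, a, c), (c, c, a)} →
      K a a b = -2 * K a c c → K a c c = 0 := by
    rintro a b c d hd ⟨hab, hac, hbc, ha, hb, hc⟩ hs hK
    have h := sum_eq_zero_of_sexticTensor hA d hd _ hs
    simp [hab, hab.symm, hac, hac.symm, hbc, ha, hb, hc] at h
    grind
  have square_mixed_three : ∀ (a b c e : Fin 6) (d : Fin 3 → ℕ) (hd : d 0 + d 1 + d 2 = 6),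
      (a ≠ b ∧ a ≠ c ∧ a ≠ e ∧ c ≠ e ∧ b ≠ c ∧ b ≠ e ∧
        nuCoeff a = 1 ∧ nuCoeff b = 2 ∧ nuCoeff c = 2 ∧ nuCoeff e = 2) →
      Finset.univ.filter (fun p : Fin 6 × Fin 6 × Fin 6 =>
      nuWeight p.1 + nuWeight p.2.1 + nuWeight p.2.2 = d) =
        {(a, a, b), (a, b, a), (b, a, a), (a, c, e), (c, a, e), (c, e, a), (a, e, c), (e, a, c),
          (e, c, a)} →
      K a a b = -2 * K a c e → K a c e = 0 := by
    rintro a b c e d hd ⟨hab, hac, hae, hce, hbc, hbe, ha, hb, hc, he⟩ hs hK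
    have h := sum_eq_zero_of_sexticTensor hA d hd _ hs
    simp [hab, hab.symm, hac, hac.symm, hae, hae.symm, hbc, hbe, hce, hce.symm,
      ha, hb, hc, he] at h
    grind
  have cube_mixed : ∀ (a b c : Fin 6) (d : Fin 3 → ℕ) (hd : d 0 + d 1 + d 2 = 6),
      (a ≠ b ∧ a ≠ c ∧ b ≠ c ∧ nuCoeff a = 1 ∧ nuCoeff b = 1 ∧ nuCoeff c = 2) →
      Finset.univ.filter (fun p : Fin 6 × Fin 6 × Fin 6 =>
      nuWeight p.1 + nuWeight p.2.1 + nuWeight p.2.2 = d) =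
        {(a, b, c), (b, a, c), (b, c, a), (a, c, b), (c, a, b), (c, b, a), (c, c, c)} →
      K c a b = -2 * K c c c → K c c c = 0 := by
    rintro a b c d hd ⟨hab, hac, hbc, ha, hb, hc⟩ hs hK
    have h := sum_eq_zero_of_sexticTensor hA d hd _ hs
    simp [hab, hab.symm, hac, hac.symm, hbc, ha, hb, hc] at h
    grind
  have k000 := cube 0 ![6, 0, 0] rfl (by decide) (by decide)
  have k333 := cube 3 ![0, 6, 0] rfl (by decide) (by decide)
  have k555 := cube 5 ![0, 0, 6] rfl (by decide) (by decide)
  have k001 := square 0 1 ![5, 1, 0] rfl (by decide) (by decide)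
  have k002 := square 0 2 ![5, 0, 1] rfl (by decide) (by decide)
  have k331 := square 3 1 ![1, 5, 0] rfl (by decide) (by decide)
  have k334 := square 3 4 ![0, 5, 1] rfl (by decide) (by decide)
  have k552 := square 5 2 ![1, 0, 5] rfl (by decide) (by decide)
  have k554 := square 5 4 ![0, 1, 5] rfl (by decide) (by decide)
  have k011 := square_mixed 0 3 1 ![4, 2, 0] rfl (by decide) (by decide) (b5 0)
  have k022 := square_mixed 0 5 2 ![4, 0, 2] rfl (by decide) (by decide) (b3 0)
  have k344 := square_mixed 3 5 4 ![0, 4, 2] rfl (by decide) (by decide) (b0 3)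
  have k311 := square_mixed 3 0 1 ![2, 4, 0] rfl (by decide) (by decide) (by rw [← b5, h₂])
  have k522 := square_mixed 5 0 2 ![2, 0, 4] rfl (by decide) (by decide) (by rw [← b3, h₂])
  have k544 := square_mixed 5 3 4 ![0, 2, 4] rfl (by decide) (by decide) (by rw [← b0, h₂])
  have k012 := square_mixed_three 0 4 1 2 ![4, 1, 1] rfl (by decide) (by decide) (b4 0)
  have k314 := square_mixed_three 3 2 1 4 ![1, 4, 1] rfl (by decide) (by decide) (by rw [← b2, h₂])
  have k524 := square_mixed_three 5 1 2 4 ![1, 1, 4] rfl (by decide) (by decide) (by rw [← b1, h₂])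
  have k111 := cube_mixed 0 3 1 ![3, 3, 0] rfl (by decide) (by decide) (b5 1)
  have k222 := cube_mixed 0 5 2 ![3, 0, 3] rfl (by decide) (by decide) (b3 2)
  have k444 := cube_mixed 3 5 4 ![0, 3, 3] rfl (by decide) (by decide) (b0 4)
  clear cube square square_mixed square_mixed_three cube_mixed hA hB hB'
  have k112 : K 1 1 2 = 0 := by grind [b5 2, b2 0, b4 1]
  have k122 : K 1 2 2 = 0 := by grind [b3 1, b1 0, b4 2]
  have k114 : K 1 1 4 = 0 := by grind [b5 4, b2 1, b4 3]
  have k144 : K 1 4 4 = 0 := by grind [b0 1, b1 3, b2 4]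
  have k224 : K 2 2 4 = 0 := by grind [b3 4, b4 5, b1 2]
  have k244 : K 2 4 4 = 0 := by grind [b0 2, b2 5, b1 4]
  have k035 : K 0 3 5 = 0 := by grind [b3 3, b0 0, b5 5, b1 1, b2 2]
  have key : ∀ a b c, a ≤ b → b ≤ c → K a b c = 0 := by
    intro a b c hab hbc
    fin_cases a <;> fin_cases b <;> first | exact absurd hab (by decide) | skip
    all_goals fin_cases c <;> first | exact absurd hbc (by decide) | skip
    all_goals simp only [Fin.zero_eta, Fin.mk_one, Fin.reduceFinMk]
    all_goals grind
  ext a b c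
  have h1 := key a b c
  have h2 := key a c b
  have h3 := key b a c
  have h4 := key b c a
  have h5 := key c a b
  have h6 := key c b a
  change K a b c = 0
  rcases le_total a b with hab | hab <;> rcases le_total b c with hbc | hbc <;>
    rcases le_total a c with hac | hac <;> grind

/-- For generic `g`, a symmetric tensor orthogonal to all sextics whose contractions with `g` vanish
is determined by its entry at `(1, 2, 4)`. -/
theorem exists_generic_symmetric_unique :
    ∃ Q : MvPolynomial SexticExponent ℂ, Q ≠ 0 ∧ ∀ g : SexticExponent → ℂ, eval g Q ≠ 0 →
      ∀ K : Fin 6 → Fin 6 → Fin 6 → ℂ,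
      (∀ a b c, K a b c = K b a c) → (∀ a b c, K a b c = K a c b) →
      (∀ d, ∑ a, ∑ b, ∑ c, K a b c * sexticTensor d a b c = 0) →
      (∀ a s, ∑ d, g d * ∑ b, ∑ c, K a b c * sexticTensor d s b c = 0) →
      K 1 2 4 = 0 → K = 0 := by
  let e (a b c : Fin 6) : (Fin 6 → Fin 6 → Fin 6 → ℂ) →ₗ[ℂ] ℂ :=
    LinearMap.proj c ∘ₗ LinearMap.proj b ∘ₗ LinearMap.proj a
  let M₀ := (LinearMap.pi fun p : Fin 6 × Fin 6 × Fin 6 =>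
      e p.1 p.2.1 p.2.2 - e p.2.1 p.1 p.2.2).prod <|
    (LinearMap.pi fun p : Fin 6 × Fin 6 × Fin 6 => e p.1 p.2.1 p.2.2 - e p.1 p.2.2 p.2.1).prod <|
    (LinearMap.pi fun d : SexticExponent => ∑ a, ∑ b, ∑ c, sexticTensor d a b c • e a b c).prod <|
    (0 : _ →ₗ[ℂ] Fin 6 × Fin 6 → ℂ).prod (e 1 2 4)
  let M₁ (d : SexticExponent) :=
    (0 : (Fin 6 → Fin 6 → Fin 6 → ℂ) →ₗ[ℂ] Fin 6 × Fin 6 × Fin 6 → ℂ).prod <|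
    (0 : _ →ₗ[ℂ] Fin 6 × Fin 6 × Fin 6 → ℂ).prod <| (0 : _ →ₗ[ℂ] SexticExponent → ℂ).prod <|
    (LinearMap.pi fun p : Fin 6 × Fin 6 => ∑ b, ∑ c, sexticTensor d p.2 b c • e p.1 b c).prod
      (0 : _ →ₗ[ℂ] ℂ)
  have hM : ∀ (g : SexticExponent → ℂ) K, (M₀ + ∑ d, g d • M₁ d) K = 0 ↔
      (∀ a b c, K a b c = K b a c) ∧ (∀ a b c, K a b c = K a c b) ∧
      (∀ d, ∑ a, ∑ b, ∑ c, K a b c * sexticTensor d a b c = 0) ∧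
      (∀ a s, ∑ d, g d * ∑ b, ∑ c, K a b c * sexticTensor d s b c = 0) ∧ K 1 2 4 = 0 := by
    intro g K
    simp [M₀, M₁, e, Prod.ext_iff, funext_iff, LinearMap.sum_apply, Prod.fst_sum, Prod.snd_sum,
      sub_eq_zero, mul_comm]
  classical
  obtain ⟨Q, hQ, h⟩ := exists_generic_injective M₀ M₁
    (Pi.single (sexticExponent ![2, 2, 2] (by decide)) 1) (by
      rw [LinearMap.ker_eq_bot']
      intro K hK
      obtain ⟨h₁, h₂, hA, hB, h124⟩ := (hM _ K).1 hK
      refine eq_zero_of_contractions h₁ h₂ hA (fun a s => ?_) h124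
      simpa [Pi.single_apply] using hB a s)
  exact ⟨Q, hQ, fun g hg K h₁ h₂ hA hB h124 => h g hg K ((hM g K).2 ⟨h₁, h₂, hA, hB, h124⟩)⟩

/-- The pullback of the tensor `detTensor` along a matrix. -/
noncomputable def detPullback (B : Matrix (Fin 6) (Fin 6) ℂ) (a b c : Fin 6) : ℂ :=
  ∑ i, ∑ j, ∑ k, (detTensor i j k : ℂ) * (B i a * B j b * B k c)

theorem detPullback_swap_left (B : Matrix (Fin 6) (Fin 6) ℂ) (a b c : Fin 6) :
    detPullback B a b c = detPullback B b a c := by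
  rw [detPullback, detPullback, Finset.sum_comm]
  refine Finset.sum_congr rfl fun j _ => Finset.sum_congr rfl fun i _ =>
    Finset.sum_congr rfl fun k _ => ?_
  rw [detTensor_swap_left, mul_comm (B i a)]

theorem detPullback_swap_right (B : Matrix (Fin 6) (Fin 6) ℂ) (a b c : Fin 6) :
    detPullback B a b c = detPullback B a c b := by
  refine Finset.sum_congr rfl fun i _ => ?_
  rw [Finset.sum_comm]
  refine Finset.sum_congr rfl fun j _ => Finset.sum_congr rfl fun k _ => ?_
  rw [detTensor_swap_right, mul_right_comm]

theorem sum_detPullback_mul (B : Matrix (Fin 6) (Fin 6) ℂ) (y : Fin 6 → ℂ) (a : Fin 6) :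
    ∑ b, ∑ c, detPullback B a b c * (y b * y c) =
      ∑ i, (∑ j, ∑ k, (detTensor i j k : ℂ) * (B.mulVec y j * B.mulVec y k)) * B i a := by
  have h := Finset.sum_comm (s := (Finset.univ : Finset (Fin 6 × Fin 6)))
    (t := (Finset.univ : Finset (Fin 6 × Fin 6 × Fin 6))) (f := fun p q =>
      (detTensor q.1 q.2.1 q.2.2 : ℂ) * ((B q.2.1 p.1 * y p.1) * (B q.2.2 p.2 * y p.2)) * B q.1 a)
  simp only [Fintype.sum_prod_type] at h
  have hmul : ∀ j, B.mulVec y j = ∑ b, B j b * y b := fun _ => rfl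
  simp only [hmul, Finset.sum_mul_sum]
  simp only [Finset.mul_sum, Finset.sum_mul, detPullback]
  refine Eq.trans ?_ h
  refine Finset.sum_congr rfl fun b _ => Finset.sum_congr rfl fun c _ =>
    Finset.sum_congr rfl fun i _ => Finset.sum_congr rfl fun j _ =>
    Finset.sum_congr rfl fun k _ => by ring

/-- If the pullback of the determinant along an invertible matrix is proportional to the
determinant, the matrix preserves the cone over the Veronese surface. -/
theorem mulVec_mem_range_nu_iff {A B : Matrix (Fin 6) (Fin 6) ℂ} (hBA : B * A = 1) {l : ℂ}
    (h : ∀ a b c, detPullback B a b c = l * detTensor a b c) (x : Fin 6 → ℂ) :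
    B.mulVec x ∈ Set.range nu ↔ x ∈ Set.range nu := by
  let grad (y : Fin 6 → ℂ) (i : Fin 6) : ℂ := ∑ j, ∑ k, (detTensor i j k : ℂ) * (y j * y k)
  have hgrad : ∀ y, Matrix.vecMul (grad (B.mulVec y)) B = l • grad y := by
    intro y
    ext a
    rw [Matrix.vecMul, dotProduct, ← sum_detPullback_mul]
    simp [grad, h, Finset.mul_sum, mul_assoc]
  have hinj : ∀ v, Matrix.vecMul v B = 0 → v = 0 := by
    intro v hv
    simpa [Matrix.vecMul_vecMul, hBA] using congrArg (fun u => Matrix.vecMul u A) hv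
  have hl : l ≠ 0 := by
    rintro rfl
    have h5 := congrFun (hinj _ ((hgrad (A.mulVec ![1, 0, 0, 1, 0, 0])).trans (zero_smul _ _))) 5
    rw [Matrix.mulVec_mulVec, hBA, Matrix.one_mulVec] at h5
    simp [grad, sum_detTensor_mul] at h5
  have hiff : ∀ y, y ∈ Set.range nu ↔ grad y = 0 := fun y => by
    rw [mem_range_nu_iff, funext_iff]
    rfl
  rw [hiff, hiff]
  constructor
  · intro h0
    have h1 := hgrad x
    rw [h0, Matrix.zero_vecMul] at h1
    exact (smul_eq_zero.1 h1.symm).resolve_left hl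
  · intro h0
    exact hinj _ (by rw [hgrad, h0, smul_zero])

theorem isHomogeneous_nuPoly (a : Fin 6) : (nuPoly a).IsHomogeneous 2 := by
  rw [nuPoly_eq_monomial]
  apply isHomogeneous_monomial
  rw [Finsupp.degree_eq_sum, Fin.sum_univ_three]
  fin_cases a <;> simp [nuWeight]

theorem isHomogeneous_linForm {n : ℕ} (v : Fin n → ℂ) : (linForm v).IsHomogeneous 1 :=
  IsHomogeneous.sum _ _ _ fun i _ => (isHomogeneous_X ℂ i).C_mul (v i)

theorem eval_linForm {n : ℕ} (v x : Fin n → ℂ) : eval x (linForm v) = v ⬝ᵥ x := by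
  simp [linForm, dotProduct]

/-- The equations satisfied by a matrix whose inverse carries the Veronese cone to a cone apolar to
a given sextic. -/
theorem sum_eq_zero_of_apolar {g : MvPolynomial (Fin 3) ℂ} {A B : Matrix (Fin 6) (Fin 6) ℂ}
    (hBA : B * A = 1)
    (h : ∀ k : MvPolynomial (Fin 6) ℂ, k.IsHomogeneous 3 →
      (∀ w, eval (A.mulVec (nu w)) k = 0) → pairing g (aeval nuPoly k) = 0) (i s : Fin 6) :
    ∑ q : Fin 6 × Fin 6, ∑ r : Fin 6 × Fin 6, ∑ d : SexticExponent,
      (detTensor i q.1 r.1 : ℂ) * sexticTensor d s q.2 r.2 *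
        (B q.1 q.2 * B r.1 r.2 * coeff d.1 g) = 0 := by
  let k : MvPolynomial (Fin 6) ℂ :=
    ∑ j, ∑ l, C (detTensor i j l : ℂ) * (linForm (B j) * linForm (B l) * X s)
  have hk : k.IsHomogeneous 3 := IsHomogeneous.sum _ _ _ fun j _ => IsHomogeneous.sum _ _ _ fun l _ =>
    (((isHomogeneous_linForm _).mul (isHomogeneous_linForm _)).mul (isHomogeneous_X ℂ s)).C_mul _
  have hvanish : ∀ w, eval (A.mulVec (nu w)) k = 0 := by
    intro w
    have hB : ∀ j, B j ⬝ᵥ A.mulVec (nu w) = nu w j := fun j => by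
      change B.mulVec (A.mulVec (nu w)) j = _
      rw [Matrix.mulVec_mulVec, hBA, Matrix.one_mulVec]
    simp only [k, map_sum, map_mul, eval_C, eval_linForm, hB, ← mul_assoc, ← Finset.sum_mul]
    simp only [mul_assoc, sum_detTensor_mul_nu, zero_mul]
  have haeval : aeval nuPoly k = ∑ j, ∑ l, ∑ b, ∑ c,
      C ((detTensor i j l : ℂ) * (B j b * B l c)) * (nuPoly s * nuPoly b * nuPoly c) := by
    simp only [k, linForm, map_sum, map_mul, aeval_C, aeval_X, Finset.sum_mul_sum, algebraMap_eq]
    simp only [Finset.mul_sum, Finset.sum_mul]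
    refine Finset.sum_congr rfl fun j _ => Finset.sum_congr rfl fun l _ =>
      Finset.sum_congr rfl fun b _ => Finset.sum_congr rfl fun c _ => by ring
  have hhom : (aeval nuPoly k).IsHomogeneous 6 := by
    rw [haeval]
    exact IsHomogeneous.sum _ _ _ fun j _ => IsHomogeneous.sum _ _ _ fun l _ =>
      IsHomogeneous.sum _ _ _ fun b _ => IsHomogeneous.sum _ _ _ fun c _ =>
      (((isHomogeneous_nuPoly s).mul (isHomogeneous_nuPoly b)).mul (isHomogeneous_nuPoly c)).C_mul _
  have h0 := h k hk hvanish
  rw [pairing_eq_sum _ _ hhom, haeval] at h0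
  rw [← h0]
  have e := Fintype.sum_equiv (⟨fun x => (x.2.2, x.1.1, x.2.1.1, x.1.2, x.2.1.2),
      fun y => ((y.2.1, y.2.2.2.1), (y.2.2.1, y.2.2.2.2), y.1), fun _ => rfl, fun _ => rfl⟩ :
      (Fin 6 × Fin 6) × (Fin 6 × Fin 6) × SexticExponent ≃
        SexticExponent × Fin 6 × Fin 6 × Fin 6 × Fin 6)
    (fun x => (detTensor i x.1.1 x.2.1.1 : ℂ) * sexticTensor x.2.2 s x.1.2 x.2.1.2 *
        (B x.1.1 x.1.2 * B x.2.1.1 x.2.1.2 * coeff x.2.2.1 g))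
    (fun y => (detTensor i y.2.1 y.2.2.1 : ℂ) * sexticTensor y.1 s y.2.2.2.1 y.2.2.2.2 *
        (B y.2.1 y.2.2.2.1 * B y.2.2.1 y.2.2.2.2 * coeff y.1.1 g)) (fun _ => rfl)
  simp only [Fintype.sum_prod_type] at e ⊢
  refine e.trans ?_
  simp only [coeff_sum, coeff_C_mul, Finset.mul_sum, Finset.sum_mul,
    sexticTensor]
  refine Finset.sum_congr rfl fun d _ => Finset.sum_congr rfl fun j _ =>
    Finset.sum_congr rfl fun l _ => Finset.sum_congr rfl fun b _ =>
    Finset.sum_congr rfl fun c _ => by ring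

/-- For generic `g`, a matrix satisfying the equations of `sum_eq_zero_of_apolar` pulls the
determinant back to a multiple of itself. -/
theorem exists_generic_pullback :
    ∃ Q : MvPolynomial SexticExponent ℂ, Q ≠ 0 ∧
      ∀ (B : Matrix (Fin 6) (Fin 6) ℂ) (g : SexticExponent → ℂ), eval g Q ≠ 0 →
      (∀ i s, ∑ q : Fin 6 × Fin 6, ∑ r : Fin 6 × Fin 6, ∑ d : SexticExponent,
        (detTensor i q.1 r.1 : ℂ) * sexticTensor d s q.2 r.2 *
          (B q.1 q.2 * B r.1 r.2 * g d) = 0) →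
      ∃ l : ℂ, ∀ a b c, detPullback B a b c = l * detTensor a b c := by
  obtain ⟨Q₁, hQ₁, h₁⟩ := exists_generic_cubic
    (fun (d : SexticExponent) (p q r : Fin 6 × Fin 6) =>
      (detTensor p.1 q.1 r.1 : ℂ) * sexticTensor d p.2 q.2 r.2)
    (fun d p q r => by rw [detTensor_swap_left, sexticTensor_swap_left])
    (fun d p q r => by rw [detTensor_swap_right, sexticTensor_swap_right])
  obtain ⟨Q₂, hQ₂, h₂⟩ := exists_generic_symmetric_unique
  refine ⟨Q₁ * Q₂, mul_ne_zero hQ₁ hQ₂, fun B g hg hE => ⟨detPullback B 1 2 4, ?_⟩⟩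
  rw [map_mul, mul_ne_zero_iff] at hg
  have hT : (detTensor 1 2 4 : ℂ) = 1 := by simp [detTensor]
  have hA : ∀ d, ∑ a, ∑ b, ∑ c, detPullback B a b c * sexticTensor d a b c = 0 := by
    intro d
    rw [← h₁ (fun p => B p.1 p.2) g hg.1 (fun p => hE p.1 p.2) d]
    have e := Fintype.sum_equiv (⟨fun x => ((x.2.2.2.1, x.1), (x.2.2.2.2.1, x.2.1),
        (x.2.2.2.2.2, x.2.2.1)), fun y => (y.1.2, y.2.1.2, y.2.2.2, y.1.1, y.2.1.1, y.2.2.1),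
        fun _ => rfl, fun _ => rfl⟩ : Fin 6 × Fin 6 × Fin 6 × Fin 6 × Fin 6 × Fin 6 ≃
          (Fin 6 × Fin 6) × (Fin 6 × Fin 6) × (Fin 6 × Fin 6))
      (fun x => (detTensor x.2.2.2.1 x.2.2.2.2.1 x.2.2.2.2.2 : ℂ) *
        (B x.2.2.2.1 x.1 * B x.2.2.2.2.1 x.2.1 * B x.2.2.2.2.2 x.2.2.1) *
        sexticTensor d x.1 x.2.1 x.2.2.1)
      (fun y => (detTensor y.1.1 y.2.1.1 y.2.2.1 : ℂ) * sexticTensor d y.1.2 y.2.1.2 y.2.2.2 *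
        (B y.1.1 y.1.2 * B y.2.1.1 y.2.1.2 * B y.2.2.1 y.2.2.2)) (fun _ => mul_right_comm _ _ _)
    simp only [Fintype.sum_prod_type] at e ⊢
    refine Eq.trans ?_ e
    simp only [detPullback, Finset.sum_mul]
  have hB : ∀ a s, ∑ d, g d * ∑ b, ∑ c, detPullback B a b c * sexticTensor d s b c = 0 := by
    intro a s
    have h0 : ∑ i, B i a * ∑ q : Fin 6 × Fin 6, ∑ r : Fin 6 × Fin 6, ∑ d : SexticExponent,
        (detTensor i q.1 r.1 : ℂ) * sexticTensor d s q.2 r.2 *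
          (B q.1 q.2 * B r.1 r.2 * g d) = 0 := by
      simp only [hE, mul_zero, Finset.sum_const_zero]
    rw [← h0]
    have e := Fintype.sum_equiv (⟨fun x => (x.2.2.2.1, (x.2.2.2.2.1, x.2.1),
        (x.2.2.2.2.2, x.2.2.1), x.1), fun y => (y.2.2.2, y.2.1.2, y.2.2.1.2, y.1, y.2.1.1,
        y.2.2.1.1), fun _ => rfl, fun _ => rfl⟩ :
        SexticExponent × Fin 6 × Fin 6 × Fin 6 × Fin 6 × Fin 6 ≃
          Fin 6 × (Fin 6 × Fin 6) × (Fin 6 × Fin 6) × SexticExponent)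
      (fun x => g x.1 * ((detTensor x.2.2.2.1 x.2.2.2.2.1 x.2.2.2.2.2 : ℂ) *
        (B x.2.2.2.1 a * B x.2.2.2.2.1 x.2.1 * B x.2.2.2.2.2 x.2.2.1) *
        sexticTensor x.1 s x.2.1 x.2.2.1))
      (fun y => B y.1 a * ((detTensor y.1 y.2.1.1 y.2.2.1.1 : ℂ) *
        sexticTensor y.2.2.2 s y.2.1.2 y.2.2.1.2 *
        (B y.2.1.1 y.2.1.2 * B y.2.2.1.1 y.2.2.1.2 * g y.2.2.2)))
      (fun _ => by simp only [Equiv.coe_fn_mk]; ring)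
    simp only [Fintype.sum_prod_type] at e
    simp only [Fintype.sum_prod_type, Finset.mul_sum] at e ⊢
    refine Eq.trans ?_ e
    simp only [detPullback, Finset.sum_mul, Finset.mul_sum]
  have hK := h₂ g hg.2 (fun a b c => detPullback B a b c - detPullback B 1 2 4 * detTensor a b c)
    (fun a b c => by rw [detPullback_swap_left, detTensor_swap_left])
    (fun a b c => by rw [detPullback_swap_right, detTensor_swap_right])
    (fun d => by
      simp only [sub_mul, Finset.sum_sub_distrib, hA, mul_assoc, ← Finset.mul_sum,
        sum_detTensor_mul_sexticTensor]
      simp)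
    (fun a s => by
      simp only [sub_mul, Finset.sum_sub_distrib, mul_assoc, ← Finset.mul_sum,
        sum_detTensor_mul_sexticTensor, mul_zero, sub_zero, hB])
    (by rw [hT, mul_one, sub_self])
  intro a b c
  exact sub_eq_zero.1 (congrFun (congrFun (congrFun hK a) b) c)

/-- **Proposition (lefiniteveronese), (ii).** A general cubic fourfold apolar to a
Veronese surface is apolar to only finitely many Veronese surfaces (cones). -/
theorem statement13 :
    ∃ P : MvPolynomial ((Fin 3) →₀ ℕ) ℂ,
      (∃ g₀ : MvPolynomial (Fin 3) ℂ, g₀.IsHomogeneous 6 ∧ evalCoeff g₀ P ≠ 0) ∧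
      ∀ g : MvPolynomial (Fin 3) ℂ, g.IsHomogeneous 6 → evalCoeff g P ≠ 0 →
        ∀ s : MvPolynomial (Fin 3) ℂ →ₗ[ℂ] MvPolynomial (Fin 6) ℂ, IsSMap s →
          {S : Set (Fin 6 → ℂ) |
            (∃ A : (Matrix (Fin 6) (Fin 6) ℂ)ˣ,
              S = Set.range fun w => (A : Matrix (Fin 6) (Fin 6) ℂ).mulVec (nu w)) ∧
            ∀ k : MvPolynomial (Fin 6) ℂ, k.IsHomogeneous 3 →
              (∀ x ∈ S, eval x k = 0) → pairing (s g) k = 0}.Finite := by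
  classical
  obtain ⟨Q, hQ, h⟩ := exists_generic_pullback
  have heval : ∀ g : MvPolynomial (Fin 3) ℂ, evalCoeff g (rename Subtype.val Q) =
      eval (fun d : SexticExponent => coeff d.1 g) Q := fun g => by
    rw [evalCoeff, eval_rename]
    rfl
  refine ⟨rename Subtype.val Q, ?_, fun g hg hgP s hs => ?_⟩
  · obtain ⟨x, hx⟩ : ∃ x, eval x Q ≠ 0 := by
      by_contra! hx
      exact hQ (MvPolynomial.funext fun x => by rw [hx, map_zero])
    refine ⟨∑ d : SexticExponent, monomial d.1 (x d), IsHomogeneous.sum _ _ _ fun d _ =>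
      isHomogeneous_monomial _ ((mem_finsuppAntidiag_iff_degree _).1 d.2), ?_⟩
    rw [heval]
    convert hx
    simp [coeff_sum, coeff_monomial]
  · refine (Set.finite_singleton (Set.range nu)).subset ?_
    rintro S ⟨⟨A, rfl⟩, hS⟩
    obtain ⟨l, hl⟩ := h A⁻¹.1 (fun d => coeff d.1 g) (by rwa [← heval])
      (sum_eq_zero_of_apolar A.inv_mul fun k hk hkv => by
        rw [← hs.2 g k hg hk]
        exact hS k hk (by rintro _ ⟨w, rfl⟩; exact hkv w))
    ext x
    rw [← mulVec_mem_range_nu_iff A.inv_mul hl]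
    constructor
    · rintro ⟨w, rfl⟩
      exact ⟨w, by simp [Matrix.mulVec_mulVec]⟩
    · rintro ⟨w, hw⟩
      exact ⟨w, by simp [hw, Matrix.mulVec_mulVec]⟩
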